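/- Let 𝔅 be nonsingular, b ∈ ℝ^l, w = [x; y; z] = 𝔅^{-1}b, L ∈ ℝ^{k×l}. Let Φ₁ ∈ ℝ^{n²×s₁}, Φ₂ ∈ ℝ^{m²×r}, Φ₃ ∈ ℝ^{p²×q} be structure matrices: each has all entries in {0,1}, exactly one nonzero entry in each row, and at least one nonzero entry in each column. Let ξ ∈ ℝ^k and χ ∈ ℝ^l have all entries nonzero; let ψ_A ∈ ℝ^{s₁}, ψ_D ∈ ℝ^r, ψ_E ∈ ℝ^q have all entries nonzero and set Ψ_A, Ψ_D, Ψ_E by vec(Ψ_A) = Φ₁·ψ_A, vec(Ψ_D) = Φ₂·ψ_D, vec(Ψ_E) = Φ₃·ψ_E; let Ψ_B ∈ ℝ^{m×n}, Ψ_C ∈ ℝ^{p×m} have all entries nonzero. For ε > 0 let S(ε) be the supremum of ‖ ξ‡ ⊙ ( L(𝔅+Δ𝔅)^{-1}(b+Δb) − L𝔅^{-1}b ) ‖_∞ / ‖ [ψ_A‡⊙Δa; vec(Ψ_B‡⊙ΔB); vec(Ψ_C‡⊙ΔC); ψ_D‡⊙Δd; ψ_E‡⊙Δe; χ‡⊙Δb]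 ‖_∞ over all Δa ∈ ℝ^{s₁}, ΔB ∈ ℝ^{m×n}, ΔC ∈ ℝ^{p×m}, Δd ∈ ℝ^r, Δe ∈ ℝ^q, Δb ∈ ℝ^l such that, with vec(ΔA) = Φ₁·Δa, vec(ΔD) = Φ₂·Δd, vec(ΔE) = Φ₃·Δe, the matrix Δ𝔅 = [[ΔA, ΔBᵀ, 0],[ΔB, −ΔD, ΔCᵀ],[0, ΔC, ΔE]] makes 𝔅+Δ𝔅 nonsingular and the perturbation measure in the denominator lies in (0, ε]. Then S(ε) tends, as ε → 0⁺, to ‖ |Θ_{ξ‡}| · | L·𝔅^{-1}·[𝒢, −I_l]·blkdiag(Φ_S, I_l) | · [ |ψ_A|; vec(|Ψ_B|); vec(|Ψ_C|); |ψ_D|; |ψ_E|; |χ| ] ‖_∞, where Φ_S = blkdiag(Φ₁, I_{nm+mp}, Φ₂, Φ₃). -/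

import Mathlib

open Matrix Filter Topology

noncomputable section

/-- Index type for block vectors of sizes `n, m, p` (the paper's `l = n + m + p`). -/
abbrev Idx (n m p : ℕ) := Fin n ⊕ (Fin m ⊕ Fin p)

/-- Index type for the stacked vector `[vec A; vec B; vec C; vec D; vec E]`
(the paper's `s = n² + nm + mp + m² + p²`). -/
abbrev GIdx (n m p : ℕ) :=
  (Fin n × Fin n) ⊕ ((Fin n × Fin m) ⊕ ((Fin m × Fin p) ⊕ ((Fin m × Fin m) ⊕ (Fin p × Fin p))))

/-- Column-stacking vectorization of a `q × r` matrix: `vecC X (j, i) = X i j`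
(index = (column, row)). -/
def vecC {q r : ℕ} (X : Matrix (Fin q) (Fin r) ℝ) : Fin r × Fin q → ℝ := fun c => X c.2 c.1

/-- The double saddle point block matrix `[[A, Bᵀ, 0], [B, -D, Cᵀ], [0, C, E]]`. -/
def dsp {n m p : ℕ} (A : Matrix (Fin n) (Fin n) ℝ) (B : Matrix (Fin m) (Fin n) ℝ)
    (C : Matrix (Fin p) (Fin m) ℝ) (D : Matrix (Fin m) (Fin m) ℝ)
    (E : Matrix (Fin p) (Fin p) ℝ) : Matrix (Idx n m p) (Idx n m p) ℝ :=
  Matrix.of fun i j =>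
    match i, j with
    | Sum.inl i, Sum.inl j => A i j
    | Sum.inl i, Sum.inr (Sum.inl j) => Bᵀ i j
    | Sum.inl _, Sum.inr (Sum.inr _) => 0
    | Sum.inr (Sum.inl i), Sum.inl j => B i j
    | Sum.inr (Sum.inl i), Sum.inr (Sum.inl j) => -D i j
    | Sum.inr (Sum.inl i), Sum.inr (Sum.inr j) => Cᵀ i j
    | Sum.inr (Sum.inr _), Sum.inl _ => 0
    | Sum.inr (Sum.inr i), Sum.inr (Sum.inl j) => C i j
    | Sum.inr (Sum.inr i), Sum.inr (Sum.inr j) => E i j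

/-- The matrix `𝒢 = [[xᵀ⊗Iₙ, Iₙ⊗yᵀ, 0, 0, 0], [0, xᵀ⊗Iₘ, Iₘ⊗zᵀ, -(yᵀ⊗Iₘ), 0],
[0, 0, yᵀ⊗Iₚ, 0, zᵀ⊗Iₚ]] ∈ ℝ^{l×s}`, written entrywise with respect to the
column-stacking indices (so that `𝒢 ·ᵥ [vec ΔA; vec ΔB; vec ΔC; vec ΔD; vec ΔE]`
is exactly the action of the Kronecker-product block matrix of the paper). -/
def calG {n m p : ℕ} (x : Fin n → ℝ) (y : Fin m → ℝ) (z : Fin p → ℝ) :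
    Matrix (Idx n m p) (GIdx n m p) ℝ :=
  Matrix.of fun i c =>
    match i, c with
    | Sum.inl i, Sum.inl (j, i') => x j * (if i = i' then 1 else 0)
    | Sum.inl i, Sum.inr (Sum.inl (j, i')) => (if i = j then 1 else 0) * y i'
    | Sum.inl _, Sum.inr (Sum.inr (Sum.inl _)) => 0
    | Sum.inl _, Sum.inr (Sum.inr (Sum.inr (Sum.inl _))) => 0
    | Sum.inl _, Sum.inr (Sum.inr (Sum.inr (Sum.inr _))) => 0
    | Sum.inr (Sum.inl _), Sum.inl _ => 0
    | Sum.inr (Sum.inl i), Sum.inr (Sum.inl (j, i')) => x j * (if i = i' then 1 else 0)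
    | Sum.inr (Sum.inl i), Sum.inr (Sum.inr (Sum.inl (j, i'))) => (if i = j then 1 else 0) * z i'
    | Sum.inr (Sum.inl i), Sum.inr (Sum.inr (Sum.inr (Sum.inl (j, i')))) =>
        -(y j * (if i = i' then 1 else 0))
    | Sum.inr (Sum.inl _), Sum.inr (Sum.inr (Sum.inr (Sum.inr _))) => 0
    | Sum.inr (Sum.inr _), Sum.inl _ => 0
    | Sum.inr (Sum.inr _), Sum.inr (Sum.inl _) => 0
    | Sum.inr (Sum.inr i), Sum.inr (Sum.inr (Sum.inl (j, i'))) => y j * (if i = i' then 1 else 0)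
    | Sum.inr (Sum.inr _), Sum.inr (Sum.inr (Sum.inr (Sum.inl _))) => 0
    | Sum.inr (Sum.inr i), Sum.inr (Sum.inr (Sum.inr (Sum.inr (j, i')))) =>
        z j * (if i = i' then 1 else 0)

/-- The stacked vector `[vec A; vec B; vec C; vec D; vec E]`. -/
def vecG {n m p : ℕ} (A : Matrix (Fin n) (Fin n) ℝ) (B : Matrix (Fin m) (Fin n) ℝ)
    (C : Matrix (Fin p) (Fin m) ℝ) (D : Matrix (Fin m) (Fin m) ℝ)
    (E : Matrix (Fin p) (Fin p) ℝ) : GIdx n m p → ℝ :=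
  Sum.elim (vecC A) (Sum.elim (vecC B) (Sum.elim (vecC C) (Sum.elim (vecC D) (vecC E))))

/-- Euclidean norm of a vector. -/
def euclNorm {ι : Type*} [Fintype ι] (v : ι → ℝ) : ℝ := Real.sqrt (∑ i, v i ^ 2)

/-- Spectral norm (largest singular value = induced 2-norm) of a real matrix. -/
def specNorm {a b : Type*} [Fintype a] [Fintype b] (M : Matrix a b ℝ) : ℝ :=
  sSup {r : ℝ | ∃ v : b → ℝ, euclNorm v = 1 ∧ r = euclNorm (M.mulVec v)}

/-- Max-norm (`‖·‖_∞`) of a vector. -/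
def infNormV {ι : Type*} [Fintype ι] (v : ι → ℝ) : ℝ := ⨆ i, |v i|

/-- Induced ∞-norm of a matrix: the maximum absolute row sum. -/
def infNormM {a b : Type*} [Fintype a] [Fintype b] (M : Matrix a b ℝ) : ℝ :=
  ⨆ i, ∑ j, |M i j|

/-- Horizontal (block-column) concatenation `[M, N]`. -/
def hcat {a b c : Type*} (M : Matrix a b ℝ) (N : Matrix a c ℝ) : Matrix a (b ⊕ c) ℝ :=
  Matrix.of fun i => Sum.elim (M i) (N i)

/-- Entrywise absolute value of a matrix. -/
def absM {a b : Type*} (M : Matrix a b ℝ) : Matrix a b ℝ := Matrix.of fun i j => |M i j|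

/-- Entrywise absolute value of a vector. -/
def absV {ι : Type*} (v : ι → ℝ) : ι → ℝ := fun i => |v i|

/-- The matrix `𝒥 = [[(‖x‖₂²+‖y‖₂²)Iₙ, xyᵀ, 0], [yxᵀ, (‖x‖₂²+‖y‖₂²+‖z‖₂²)Iₘ, yzᵀ],
[0, zyᵀ, (‖y‖₂²+‖z‖₂²)Iₚ]]`. -/
def calJ {n m p : ℕ} (x : Fin n → ℝ) (y : Fin m → ℝ) (z : Fin p → ℝ) :
    Matrix (Idx n m p) (Idx n m p) ℝ :=
  Matrix.of fun i j =>
    match i, j with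
    | Sum.inl i, Sum.inl j => (euclNorm x ^ 2 + euclNorm y ^ 2) * (if i = j then 1 else 0)
    | Sum.inl i, Sum.inr (Sum.inl j) => x i * y j
    | Sum.inl _, Sum.inr (Sum.inr _) => 0
    | Sum.inr (Sum.inl i), Sum.inl j => y i * x j
    | Sum.inr (Sum.inl i), Sum.inr (Sum.inl j) =>
        (euclNorm x ^ 2 + euclNorm y ^ 2 + euclNorm z ^ 2) * (if i = j then 1 else 0)
    | Sum.inr (Sum.inl i), Sum.inr (Sum.inr j) => y i * z j
    | Sum.inr (Sum.inr _), Sum.inl _ => 0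
    | Sum.inr (Sum.inr i), Sum.inr (Sum.inl j) => z i * y j
    | Sum.inr (Sum.inr i), Sum.inr (Sum.inr j) =>
        (euclNorm y ^ 2 + euclNorm z ^ 2) * (if i = j then 1 else 0)

/-- The scaled perturbation vector
`[vec(Ψ_A‡⊙ΔA); vec(Ψ_B‡⊙ΔB); vec(Ψ_C‡⊙ΔC); vec(Ψ_D‡⊙ΔD); vec(Ψ_E‡⊙ΔE); χ‡⊙Δb]`
(for data with all entries nonzero, `v‡` is the entrywise reciprocal). -/
def scaledPert {n m p : ℕ} (ΨA : Matrix (Fin n) (Fin n) ℝ) (ΨB : Matrix (Fin m) (Fin n) ℝ)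
    (ΨC : Matrix (Fin p) (Fin m) ℝ) (ΨD : Matrix (Fin m) (Fin m) ℝ)
    (ΨE : Matrix (Fin p) (Fin p) ℝ) (χ : Idx n m p → ℝ)
    (ΔA : Matrix (Fin n) (Fin n) ℝ) (ΔB : Matrix (Fin m) (Fin n) ℝ)
    (ΔC : Matrix (Fin p) (Fin m) ℝ) (ΔD : Matrix (Fin m) (Fin m) ℝ)
    (ΔE : Matrix (Fin p) (Fin p) ℝ) (Δb : Idx n m p → ℝ) : GIdx n m p ⊕ Idx n m p → ℝ :=
  Sum.elim (fun c => (vecG ΨA ΨB ΨC ΨD ΨE c)⁻¹ * vecG ΔA ΔB ΔC ΔD ΔE c)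
    (fun i => (χ i)⁻¹ * Δb i)

/-- The vector `ℋ = [|A||x| + |B|ᵀ|y|; |B||x| + |D||y| + |C|ᵀ|z|; |C||y| + |E||z|]`. -/
def calH {n m p : ℕ} (A : Matrix (Fin n) (Fin n) ℝ) (B : Matrix (Fin m) (Fin n) ℝ)
    (C : Matrix (Fin p) (Fin m) ℝ) (D : Matrix (Fin m) (Fin m) ℝ)
    (E : Matrix (Fin p) (Fin p) ℝ) (x : Fin n → ℝ) (y : Fin m → ℝ) (z : Fin p → ℝ) :
    Idx n m p → ℝ :=
  Sum.elim ((absM A).mulVec (absV x) + (absM B)ᵀ.mulVec (absV y))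
    (Sum.elim
      ((absM B).mulVec (absV x) + (absM D).mulVec (absV y) + (absM C)ᵀ.mulVec (absV z))
      ((absM C).mulVec (absV y) + (absM E).mulVec (absV z)))

/-- Index type of the structured (generating-vector) parameter space
`[a; vec B; vec C; d; e]`. -/
abbrev SIdx (n m p s₁ r q : ℕ) :=
  Fin s₁ ⊕ (((Fin n × Fin m) ⊕ (Fin m × Fin p)) ⊕ (Fin r ⊕ Fin q))

/-- `Φ_S = blkdiag(Φ₁, I_{nm+mp}, Φ₂, Φ₃)`. -/
def PhiS {n m p s₁ r q : ℕ} (Φ₁ : Matrix (Fin n × Fin n) (Fin s₁) ℝ)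
    (Φ₂ : Matrix (Fin m × Fin m) (Fin r) ℝ) (Φ₃ : Matrix (Fin p × Fin p) (Fin q) ℝ) :
    Matrix (GIdx n m p) (SIdx n m p s₁ r q) ℝ :=
  Matrix.of fun i j =>
    match i, j with
    | Sum.inl i, Sum.inl j => Φ₁ i j
    | Sum.inr (Sum.inl i), Sum.inr (Sum.inl (Sum.inl j)) => if i = j then 1 else 0
    | Sum.inr (Sum.inr (Sum.inl i)), Sum.inr (Sum.inl (Sum.inr j)) => if i = j then 1 else 0
    | Sum.inr (Sum.inr (Sum.inr (Sum.inl i))), Sum.inr (Sum.inr (Sum.inl j)) => Φ₂ i j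
    | Sum.inr (Sum.inr (Sum.inr (Sum.inr i))), Sum.inr (Sum.inr (Sum.inr j)) => Φ₃ i j
    | _, _ => 0

/-- The structured scaled perturbation vector
`[ψ_A‡⊙Δa; vec(Ψ_B‡⊙ΔB); vec(Ψ_C‡⊙ΔC); ψ_D‡⊙Δd; ψ_E‡⊙Δe; χ‡⊙Δb]`. -/
def structPert {n m p s₁ r q : ℕ} (ψA : Fin s₁ → ℝ) (ΨB : Matrix (Fin m) (Fin n) ℝ)
    (ΨC : Matrix (Fin p) (Fin m) ℝ) (ψD : Fin r → ℝ) (ψE : Fin q → ℝ) (χ : Idx n m p → ℝ)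
    (Δa : Fin s₁ → ℝ) (ΔB : Matrix (Fin m) (Fin n) ℝ) (ΔC : Matrix (Fin p) (Fin m) ℝ)
    (Δd : Fin r → ℝ) (Δe : Fin q → ℝ) (Δb : Idx n m p → ℝ) :
    SIdx n m p s₁ r q ⊕ Idx n m p → ℝ :=
  Sum.elim
    (Sum.elim (fun j => (ψA j)⁻¹ * Δa j)
      (Sum.elim
        (Sum.elim (fun c => (vecC ΨB c)⁻¹ * vecC ΔB c) (fun c => (vecC ΨC c)⁻¹ * vecC ΔC c))
        (Sum.elim (fun j => (ψD j)⁻¹ * Δd j) (fun j => (ψE j)⁻¹ * Δe j))))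
    (fun i => (χ i)⁻¹ * Δb i)

/-- The EILS augmented matrix `𝔅̂ = [[0, 0, C], [0, J, M], [Cᵀ, Mᵀ, 0]]`
(block sizes `p, n, m`). -/
def eilsAug {n m p : ℕ} (J : Matrix (Fin n) (Fin n) ℝ) (M : Matrix (Fin n) (Fin m) ℝ)
    (C : Matrix (Fin p) (Fin m) ℝ) :
    Matrix (Fin p ⊕ (Fin n ⊕ Fin m)) (Fin p ⊕ (Fin n ⊕ Fin m)) ℝ :=
  Matrix.of fun i j =>
    match i, j with
    | Sum.inl i, Sum.inr (Sum.inr j) => C i j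
    | Sum.inr (Sum.inl i), Sum.inr (Sum.inl j) => J i j
    | Sum.inr (Sum.inl i), Sum.inr (Sum.inr j) => M i j
    | Sum.inr (Sum.inr i), Sum.inl j => Cᵀ i j
    | Sum.inr (Sum.inr i), Sum.inr (Sum.inl j) => Mᵀ i j
    | _, _ => 0

/-- The block permutation matrix `Σ = [[0, Iₙ, 0], [0, 0, Iₘ], [I_p, 0, 0]]`
(block rows of sizes `n, m, p`; block columns of sizes `p, n, m`). -/
def sigmaPerm (n m p : ℕ) : Matrix (Idx n m p) (Fin p ⊕ (Fin n ⊕ Fin m)) ℝ :=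
  Matrix.of fun i j =>
    match i, j with
    | Sum.inl i, Sum.inr (Sum.inl j) => if i = j then 1 else 0
    | Sum.inr (Sum.inl i), Sum.inr (Sum.inr j) => if i = j then 1 else 0
    | Sum.inr (Sum.inr i), Sum.inl j => if i = j then 1 else 0
    | _, _ => 0

/-- The matrix `𝒢̂ = [[yᵀ⊗Iₙ, 0], [Iₘ⊗xᵀ, Iₘ⊗zᵀ], [0, yᵀ⊗I_p]] ∈ ℝ^{l×m(n+p)}`,
written entrywise with respect to column-stacking indices of `[vec(ΔBᵀ); vec(ΔC)]`. -/
def hatG {n m p : ℕ} (x : Fin n → ℝ) (y : Fin m → ℝ) (z : Fin p → ℝ) :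
    Matrix (Idx n m p) ((Fin m × Fin n) ⊕ (Fin m × Fin p)) ℝ :=
  Matrix.of fun i c =>
    match i, c with
    | Sum.inl i, Sum.inl (j, i') => y j * (if i = i' then 1 else 0)
    | Sum.inl _, Sum.inr _ => 0
    | Sum.inr (Sum.inl i), Sum.inl (j, i') => (if i = j then 1 else 0) * x i'
    | Sum.inr (Sum.inl i), Sum.inr (j, i') => (if i = j then 1 else 0) * z i'
    | Sum.inr (Sum.inr _), Sum.inl _ => 0
    | Sum.inr (Sum.inr i), Sum.inr (j, i') => y j * (if i = i' then 1 else 0)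

lemma infNormV_eq_norm {ι : Type*} [Fintype ι] (v : ι → ℝ) : infNormV v = ‖v‖ := by
  unfold infNormV
  rcases isEmpty_or_nonempty ι with h | h
  · rw [Real.iSup_of_isEmpty, Subsingleton.elim v 0, norm_zero]
  · refine le_antisymm (ciSup_le fun i => norm_le_pi_norm v i) ?_
    exact (pi_norm_le_iff_of_nonempty _).2 fun i =>
      le_ciSup (f := fun i => |v i|) (Set.finite_range _).bddAbove i

/-- The worst-case relative growth of a map over shrinking balls converges to the operator
norm of its linear part. -/
lemma tendsto_sSup_norm_div_norm {V W : Type*} [NormedAddCommGroup V] [NormedSpace ℝ V]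
    [NormedAddCommGroup W] [NormedSpace ℝ W] (f : V → W) (T : V →L[ℝ] W) {U : Set V}
    (hU : U ∈ 𝓝 (0 : V)) (hf : (fun u => f u - T u) =o[𝓝 0] fun u : V => u) :
    Tendsto (fun ε : ℝ => sSup {t : ℝ | ∃ u, u ∈ U ∧ 0 < ‖u‖ ∧ ‖u‖ ≤ ε ∧ t = ‖f u‖ / ‖u‖})
      (𝓝[>] 0) (𝓝 ‖T‖) := by
  rw [Metric.tendsto_nhds]
  intro c hc
  obtain ⟨δ, hδ, hball⟩ := Metric.mem_nhds_iff.1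
    (inter_mem hU (hf.def (half_pos hc)))
  filter_upwards [Ioo_mem_nhdsGT hδ] with ε hε
  set S := {t : ℝ | ∃ u, u ∈ U ∧ 0 < ‖u‖ ∧ ‖u‖ ≤ ε ∧ t = ‖f u‖ / ‖u‖}
  have hmem : ∀ u : V, ‖u‖ ≤ ε → u ∈ U ∧ ‖f u - T u‖ ≤ c / 2 * ‖u‖ := fun u hu =>
    hball (mem_ball_zero_iff.2 (hu.trans_lt hε.2))
  have hup : ∀ t ∈ S, t ≤ ‖T‖ + c / 2 := by
    rintro t ⟨u, -, hu0, huε, rfl⟩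
    rw [div_le_iff₀ hu0]
    have h₁ := (hmem u huε).2
    have h₂ := T.le_opNorm u
    have h₃ := norm_le_norm_add_norm_sub' (f u) (T u)
    linarith
  have hS0 : 0 ≤ sSup S := by
    refine Real.sSup_nonneg ?_
    rintro t ⟨u, -, -, -, rfl⟩
    positivity
  have hSle : sSup S ≤ ‖T‖ + c / 2 := Real.sSup_le hup (by positivity)
  have hle : ‖T‖ ≤ sSup S + c / 2 := by
    refine T.opNorm_le_bound (by positivity) fun v => ?_
    rcases eq_or_ne v 0 with rfl | hv
    · simp
    have hv' : 0 < ‖v‖ := norm_pos_iff.2 hv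
    have ha : 0 < ε / ‖v‖ := div_pos hε.1 hv'
    have hnorm : ‖(ε / ‖v‖) • v‖ = ε := by
      rw [norm_smul, Real.norm_of_nonneg ha.le, div_mul_cancel₀ _ hv'.ne']
    have hu := hmem ((ε / ‖v‖) • v) hnorm.le
    have h₁ : ‖f ((ε / ‖v‖) • v)‖ / ε ≤ sSup S :=
      le_csSup ⟨_, hup⟩ ⟨_, hu.1, by rw [hnorm]; exact hε.1, hnorm.le, by rw [hnorm]⟩
    rw [div_le_iff₀ hε.1] at h₁
    have h₂ := hu.2
    have h₃ := norm_le_norm_add_norm_sub (f ((ε / ‖v‖) • v)) (T ((ε / ‖v‖) • v))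
    rw [hnorm] at h₂
    have h₄ : ‖T ((ε / ‖v‖) • v)‖ = ε / ‖v‖ * ‖T v‖ := by
      rw [map_smul, norm_smul, Real.norm_of_nonneg ha.le]
    have h₅ : ε / ‖v‖ * ‖T v‖ ≤ (sSup S + c / 2) * ε := by linarith
    rw [div_mul_eq_mul_div, div_le_iff₀ hv'] at h₅
    have h₆ := hε.1
    nlinarith
  rw [Real.dist_eq, abs_lt]
  constructor <;> linarith

lemma norm_mulVecLin_toContinuousLinearMap {ι κ : Type*} [Fintype ι] [Fintype κ] [DecidableEq ι]
    (M : Matrix κ ι ℝ) :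
    ‖LinearMap.toContinuousLinearMap M.mulVecLin‖ = ‖fun i => ∑ j, |M i j|‖ := by
  let _ := Matrix.linftyOpNormedAddCommGroup (m := κ) (n := ι) (α := ℝ)
  have h := Matrix.linfty_opNorm_eq_opNorm M
  rw [Matrix.linfty_opNorm_def] at h
  refine h.symm.trans ?_
  rw [Pi.norm_def]
  congr 2
  ext i
  simp [abs_of_nonneg (Finset.sum_nonneg fun j _ => abs_nonneg (M i j))]

lemma isLittleO_mulVec_sub_mulVec {ι κ μ : Type*} [Fintype ι] [Fintype κ] [Fintype μ]
    {N : (ι → ℝ) → Matrix κ μ ℝ} (hN : ContinuousAt N 0) (R : Matrix μ ι ℝ) :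
    (fun u => N u *ᵥ (R *ᵥ u) - (N 0 * R) *ᵥ u) =o[𝓝 0] fun u : ι → ℝ => u := by
  rw [Asymptotics.isLittleO_pi]
  intro i
  have hO : (fun u : ι → ℝ => R *ᵥ u) =O[𝓝 0] fun u : ι → ℝ => u :=
    (LinearMap.toContinuousLinearMap R.mulVecLin).isBigO_id (𝓝 0)
  have hsum : (fun u => ∑ j, (N u i j - N 0 i j) * (R *ᵥ u) j) =o[𝓝 0]
      fun u : ι → ℝ => ‖u‖ := by
    refine Asymptotics.IsLittleO.fun_sum fun j _ => ?_
    have h₁ : (fun u => N u i j - N 0 i j) =o[𝓝 0] fun _ : ι → ℝ => (1 : ℝ) := by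
      rw [Asymptotics.isLittleO_one_iff]
      have h : Tendsto (fun u => N u i j) (𝓝 0) (𝓝 (N 0 i j)) :=
        (continuous_apply_apply i j).continuousAt.comp hN
      simpa using h.sub_const (N 0 i j)
    simpa using h₁.mul_isBigO (Asymptotics.isBigO_pi.1 hO j).norm_right
  refine hsum.of_norm_right.congr_left fun u => ?_
  rw [← Matrix.mulVec_mulVec, Pi.sub_apply]
  simp only [sub_mul, Finset.sum_sub_distrib]
  rfl

lemma add_inv_mulVec_add_sub {ι : Type*} [Fintype ι] [DecidableEq ι] {M H : Matrix ι ι ℝ}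
    (hM : IsUnit M.det) (hMH : IsUnit (M + H).det) (b c : ι → ℝ) :
    (M + H)⁻¹ *ᵥ (b + c) - M⁻¹ *ᵥ b = -((M + H)⁻¹ *ᵥ (H *ᵥ (M⁻¹ *ᵥ b) - c)) := by
  have h : M⁻¹ *ᵥ b = (M + H)⁻¹ *ᵥ (b + H *ᵥ (M⁻¹ *ᵥ b)) := by
    have hb : b + H *ᵥ (M⁻¹ *ᵥ b) = (M + H) *ᵥ (M⁻¹ *ᵥ b) := by
      rw [Matrix.add_mulVec, Matrix.mulVec_mulVec b M, Matrix.mul_nonsing_inv _ hM,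
        Matrix.one_mulVec]
    rw [hb, Matrix.mulVec_mulVec, Matrix.nonsing_inv_mul _ hMH, Matrix.one_mulVec]
  nth_rewrite 1 [h]
  rw [← Matrix.mulVec_sub, ← Matrix.mulVec_neg]
  congr 1
  abel

/-- The double saddle point matrix whose stacked blocks are `g`. -/
def dspOfVec {n m p : ℕ} (g : GIdx n m p → ℝ) : Matrix (Idx n m p) (Idx n m p) ℝ :=
  dsp (Matrix.of fun i j => g (.inl (j, i)))
    (Matrix.of fun i j => g (.inr (.inl (j, i))))
    (Matrix.of fun i j => g (.inr (.inr (.inl (j, i)))))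
    (Matrix.of fun i j => g (.inr (.inr (.inr (.inl (j, i))))))
    (Matrix.of fun i j => g (.inr (.inr (.inr (.inr (j, i))))))

lemma dspOfVec_vecG {n m p : ℕ} (A : Matrix (Fin n) (Fin n) ℝ) (B : Matrix (Fin m) (Fin n) ℝ)
    (C : Matrix (Fin p) (Fin m) ℝ) (D : Matrix (Fin m) (Fin m) ℝ) (E : Matrix (Fin p) (Fin p) ℝ) :
    dspOfVec (vecG A B C D E) = dsp A B C D E := rfl

lemma dspOfVec_zero {n m p : ℕ} : dspOfVec (0 : GIdx n m p → ℝ) = 0 := by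
  ext (i | i | i) (j | j | j) <;> simp [dspOfVec, dsp]

lemma continuous_dspOfVec {n m p : ℕ} : Continuous (dspOfVec (n := n) (m := m) (p := p)) := by
  refine continuous_matrix fun i j => ?_
  rcases i with i | i | i <;> rcases j with j | j | j <;>
    simp only [dspOfVec, dsp, Matrix.of_apply, Matrix.transpose_apply] <;> fun_prop

lemma dspOfVec_mulVec {n m p : ℕ} (g : GIdx n m p → ℝ) (x : Fin n → ℝ) (y : Fin m → ℝ)
    (z : Fin p → ℝ) :
    dspOfVec g *ᵥ Sum.elim x (Sum.elim y z) = calG x y z *ᵥ g := by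
  ext (i | i | i)
  · simp [dspOfVec, dsp, calG, Matrix.mulVec, dotProduct, Fintype.sum_prod_type, mul_comm,
      Finset.sum_ite_irrel]
  · simp [dspOfVec, dsp, calG, Matrix.mulVec, dotProduct, Fintype.sum_prod_type, mul_comm,
      Finset.sum_ite_irrel]
    abel
  · simp [dspOfVec, dsp, calG, Matrix.mulVec, dotProduct, Fintype.sum_prod_type, mul_comm]

lemma PhiS_mulVec {n m p s₁ r q : ℕ} (Φ₁ : Matrix (Fin n × Fin n) (Fin s₁) ℝ)
    (Φ₂ : Matrix (Fin m × Fin m) (Fin r) ℝ) (Φ₃ : Matrix (Fin p × Fin p) (Fin q) ℝ)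
    (a : Fin s₁ → ℝ) (β : Fin n × Fin m → ℝ) (γ : Fin m × Fin p → ℝ) (d : Fin r → ℝ)
    (e : Fin q → ℝ) :
    PhiS Φ₁ Φ₂ Φ₃ *ᵥ Sum.elim a (Sum.elim (Sum.elim β γ) (Sum.elim d e)) =
      Sum.elim (Φ₁ *ᵥ a) (Sum.elim β (Sum.elim γ (Sum.elim (Φ₂ *ᵥ d) (Φ₃ *ᵥ e)))) := by
  ext (i | i | i | i | i) <;>
    simp [PhiS, Matrix.mulVec, dotProduct, Fintype.sum_sum_type]

lemma hcat_mulVec {a b c : Type*} [Fintype b] [Fintype c] (M : Matrix a b ℝ) (N : Matrix a c ℝ)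
    (u : b → ℝ) (v : c → ℝ) : hcat M N *ᵥ Sum.elim u v = M *ᵥ u + N *ᵥ v := by
  ext i
  simp [hcat, Matrix.mulVec, dotProduct, Fintype.sum_sum_type]

/-- The stacked vector `[a; vec B; vec C; d; e; b]`. -/
def structVec {n m p s₁ r q : ℕ} (a : Fin s₁ → ℝ) (B : Matrix (Fin m) (Fin n) ℝ)
    (C : Matrix (Fin p) (Fin m) ℝ) (d : Fin r → ℝ) (e : Fin q → ℝ) (b : Idx n m p → ℝ) :
    SIdx n m p s₁ r q ⊕ Idx n m p → ℝ :=
  Sum.elim (Sum.elim a (Sum.elim (Sum.elim (vecC B) (vecC C)) (Sum.elim d e))) b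

lemma structPert_eq {n m p s₁ r q : ℕ} (ψA : Fin s₁ → ℝ) (ΨB : Matrix (Fin m) (Fin n) ℝ)
    (ΨC : Matrix (Fin p) (Fin m) ℝ) (ψD : Fin r → ℝ) (ψE : Fin q → ℝ) (χ : Idx n m p → ℝ)
    (a : Fin s₁ → ℝ) (B : Matrix (Fin m) (Fin n) ℝ) (C : Matrix (Fin p) (Fin m) ℝ)
    (d : Fin r → ℝ) (e : Fin q → ℝ) (b : Idx n m p → ℝ) :
    structPert ψA ΨB ΨC ψD ψE χ a B C d e b =
      (structVec ψA ΨB ΨC ψD ψE χ)⁻¹ * structVec a B C d e b := by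
  ext (((i | (i | i) | i | i)) | i) <;> rfl

lemma exists_structVec_eq {n m p s₁ r q : ℕ} (δ : SIdx n m p s₁ r q ⊕ Idx n m p → ℝ) :
    ∃ a B C d e b, structVec a B C d e b = δ :=
  ⟨fun j => δ (.inl (.inl j)),
    Matrix.of fun i j => δ (.inl (.inr (.inl (.inl (j, i))))),
    Matrix.of fun i j => δ (.inl (.inr (.inl (.inr (j, i))))),
    fun j => δ (.inl (.inr (.inr (.inl j)))),
    fun j => δ (.inl (.inr (.inr (.inr j)))),
    fun j => δ (.inr j), by ext (((i | (i | i) | i | i)) | i) <;> rfl⟩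

lemma dsp_eq_dspOfVec_PhiS {n m p s₁ r q : ℕ} {Φ₁ : Matrix (Fin n × Fin n) (Fin s₁) ℝ}
    {Φ₂ : Matrix (Fin m × Fin m) (Fin r) ℝ} {Φ₃ : Matrix (Fin p × Fin p) (Fin q) ℝ}
    {A : Matrix (Fin n) (Fin n) ℝ} {D : Matrix (Fin m) (Fin m) ℝ} {E : Matrix (Fin p) (Fin p) ℝ}
    {a : Fin s₁ → ℝ} {d : Fin r → ℝ} {e : Fin q → ℝ} (B : Matrix (Fin m) (Fin n) ℝ)
    (C : Matrix (Fin p) (Fin m) ℝ) (b : Idx n m p → ℝ) (hA : vecC A = Φ₁ *ᵥ a)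
    (hD : vecC D = Φ₂ *ᵥ d) (hE : vecC E = Φ₃ *ᵥ e) :
    dsp A B C D E = dspOfVec (PhiS Φ₁ Φ₂ Φ₃ *ᵥ (structVec a B C d e b ∘ Sum.inl)) := by
  rw [structVec, Sum.elim_comp_inl, PhiS_mulVec, ← hA, ← hD, ← hE]
  rfl

/-- The structured partial condition number, with the perturbation given by the single vector
`δ = σ ⊙ u` of relative size `‖u‖`. -/
lemma tendsto_sSup_structured {n m p k : ℕ} {τ : Type*} [Fintype τ] [DecidableEq τ]
    {M : Matrix (Idx n m p) (Idx n m p) ℝ} (hM : IsUnit M.det) {b : Idx n m p → ℝ}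
    {x : Fin n → ℝ} {y : Fin m → ℝ} {z : Fin p → ℝ}
    (hw : Sum.elim x (Sum.elim y z) = M⁻¹ *ᵥ b) (L : Matrix (Fin k) (Idx n m p) ℝ)
    (P : Matrix (GIdx n m p) τ ℝ) (ξ : Fin k → ℝ) {σ : τ ⊕ Idx n m p → ℝ} (hσ : ∀ j, σ j ≠ 0) :
    Tendsto (fun ε : ℝ => sSup {t : ℝ | ∃ δ : τ ⊕ Idx n m p → ℝ,
        IsUnit (M + dspOfVec (P *ᵥ (δ ∘ Sum.inl))).det ∧ 0 < ‖σ⁻¹ * δ‖ ∧ ‖σ⁻¹ * δ‖ ≤ ε ∧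
        t = ‖fun i => (ξ i)⁻¹ *
          ((L *ᵥ ((M + dspOfVec (P *ᵥ (δ ∘ Sum.inl)))⁻¹ *ᵥ (b + δ ∘ Sum.inr))) i
            - (L *ᵥ (M⁻¹ *ᵥ b)) i)‖ / ‖σ⁻¹ * δ‖})
      (𝓝[>] 0)
      (𝓝 ‖absM (Matrix.diagonal fun i => (ξ i)⁻¹) *ᵥ
        (absM (L * M⁻¹ * hcat (calG x y z) (-1 : Matrix (Idx n m p) (Idx n m p) ℝ) *
          Matrix.fromBlocks P 0 0 (1 : Matrix (Idx n m p) (Idx n m p) ℝ)) *ᵥ absV σ)‖) := by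
  set Q : Matrix (Idx n m p) (τ ⊕ Idx n m p) ℝ :=
    hcat (calG x y z) (-1 : Matrix (Idx n m p) (Idx n m p) ℝ) *
      Matrix.fromBlocks P 0 0 (1 : Matrix (Idx n m p) (Idx n m p) ℝ) with hQ
  let X : (τ ⊕ Idx n m p → ℝ) → Matrix (Idx n m p) (Idx n m p) ℝ :=
    fun u => M + dspOfVec (P *ᵥ ((σ * u) ∘ Sum.inl))
  let N : (τ ⊕ Idx n m p → ℝ) → Matrix (Fin k) (Idx n m p) ℝ :=
    fun u => -(Matrix.diagonal (fun i => (ξ i)⁻¹) * (L * (X u)⁻¹))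
  have hX0 : X 0 = M := by
    have : (σ * (0 : τ ⊕ Idx n m p → ℝ)) ∘ Sum.inl = (0 : τ → ℝ) := by ext; simp
    simp only [X, this, Matrix.mulVec_zero, dspOfVec_zero, add_zero]
  have hX : Continuous X := by
    refine continuous_const.add (continuous_dspOfVec.comp (continuous_const.matrix_mulVec ?_))
    exact continuous_pi fun j => by simp only [Function.comp_apply, Pi.mul_apply]; fun_prop
  have hN : ContinuousAt N 0 := by
    have hinv : ContinuousAt (fun u => (X u)⁻¹) 0 := by
      refine ContinuousAt.comp (g := fun Y : Matrix (Idx n m p) (Idx n m p) ℝ => Y⁻¹) ?_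
        hX.continuousAt
      rw [hX0]
      refine continuousAt_matrix_inv _ ?_
      rw [Ring.inverse_eq_inv']
      exact continuousAt_inv₀ hM.ne_zero
    have hc : Continuous fun Y : Matrix (Idx n m p) (Idx n m p) ℝ =>
        -(Matrix.diagonal (fun i => (ξ i)⁻¹) * (L * Y)) := by fun_prop
    exact hc.continuousAt.comp hinv
  have hU : {u | IsUnit (X u).det} ∈ 𝓝 (0 : τ ⊕ Idx n m p → ℝ) := by
    have h : (X 0).det ≠ 0 := hX0 ▸ hM.ne_zero
    filter_upwards [hX.matrix_det.continuousAt.eventually_ne h] with u hu using hu.isUnit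
  have hQmul : ∀ δ : τ ⊕ Idx n m p → ℝ,
      Q *ᵥ δ = dspOfVec (P *ᵥ (δ ∘ Sum.inl)) *ᵥ (M⁻¹ *ᵥ b) - δ ∘ Sum.inr := by
    intro δ
    rw [← hw, dspOfVec_mulVec, hQ, ← Matrix.mulVec_mulVec, Matrix.fromBlocks_mulVec,
      hcat_mulVec]
    simp [Matrix.neg_mulVec, sub_eq_add_neg]
  have hlim := tendsto_sSup_norm_div_norm (fun u => N u *ᵥ ((Q * Matrix.diagonal σ) *ᵥ u))
    (LinearMap.toContinuousLinearMap (N 0 * (Q * Matrix.diagonal σ)).mulVecLin) hU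
    (isLittleO_mulVec_sub_mulVec hN _)
  rw [norm_mulVecLin_toContinuousLinearMap] at hlim
  have hdiag : ∀ u, (Q * Matrix.diagonal σ) *ᵥ u = Q *ᵥ (σ * u) := by
    intro u
    rw [← Matrix.mulVec_mulVec]
    congr 1
    ext j
    simp [Matrix.mulVec_diagonal]
  have hval : ∀ u, IsUnit (X u).det → N u *ᵥ ((Q * Matrix.diagonal σ) *ᵥ u) = fun i => (ξ i)⁻¹ *
      ((L *ᵥ ((X u)⁻¹ *ᵥ (b + (σ * u) ∘ Sum.inr))) i - (L *ᵥ (M⁻¹ *ᵥ b)) i) := by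
    intro u hu
    ext i
    rw [← Pi.sub_apply, ← Matrix.mulVec_sub, add_inv_mulVec_add_sub hM hu, hdiag, hQmul]
    simp only [N, Matrix.neg_mulVec, ← Matrix.mulVec_mulVec, Matrix.mulVec_neg, Pi.neg_apply,
      Matrix.mulVec_diagonal, mul_neg]
    rfl
  have hσu : ∀ u, σ⁻¹ * (σ * u) = u := fun u => by ext j; simp [hσ j]
  have hσδ : ∀ u, σ * (σ⁻¹ * u) = u := fun u => by ext j; simp [hσ j]
  convert hlim using 2
  · congr 1
    ext t
    constructor
    · rintro ⟨δ, hδ, h0, hε, rfl⟩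
      have hδ' : IsUnit (X (σ⁻¹ * δ)).det := by simpa only [X, hσδ] using hδ
      refine ⟨σ⁻¹ * δ, hδ', h0, hε, ?_⟩
      rw [hval _ hδ']
      simp only [X, hσδ]
    · rintro ⟨u, hu, h0, hε, rfl⟩
      refine ⟨σ * u, hu, by rwa [hσu], by rwa [hσu], ?_⟩
      rw [hval _ hu, hσu]
  · congr 1
    ext i
    have hassoc : L * M⁻¹ * hcat (calG x y z) (-1 : Matrix (Idx n m p) (Idx n m p) ℝ) *
        Matrix.fromBlocks P 0 0 (1 : Matrix (Idx n m p) (Idx n m p) ℝ) = L * M⁻¹ * Q := by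
      rw [hQ, Matrix.mul_assoc (L * M⁻¹)]
    have hrow : N 0 * (Q * Matrix.diagonal σ) =
        -(Matrix.diagonal (fun i => (ξ i)⁻¹) * (L * M⁻¹ * Q * Matrix.diagonal σ)) := by
      simp only [N, hX0, Matrix.neg_mul, Matrix.mul_assoc]
    have habs : absM (Matrix.diagonal fun i => (ξ i)⁻¹) =
        Matrix.diagonal fun i => |(ξ i)⁻¹| := by
      ext i j
      rcases eq_or_ne i j with rfl | h
      · simp [absM]
      · simp [absM, h]
    rw [hassoc, hrow, habs, Matrix.mulVec_diagonal, Matrix.mulVec, dotProduct, Finset.mul_sum]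
    refine Finset.sum_congr rfl fun j _ => ?_
    rw [Matrix.neg_apply, abs_neg, Matrix.diagonal_mul, Matrix.mul_diagonal, abs_mul, abs_mul]
    rfl

/-- Theorem 4.2: structured partial condition number, ∞-norm case. -/
theorem stmt16 {n m p k s₁ r q : ℕ}
    (A : Matrix (Fin n) (Fin n) ℝ) (B : Matrix (Fin m) (Fin n) ℝ) (C : Matrix (Fin p) (Fin m) ℝ)
    (D : Matrix (Fin m) (Fin m) ℝ) (E : Matrix (Fin p) (Fin p) ℝ)
    (hB : IsUnit (dsp A B C D E).det) (b : Idx n m p → ℝ)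
    (x : Fin n → ℝ) (y : Fin m → ℝ) (z : Fin p → ℝ)
    (hw : Sum.elim x (Sum.elim y z) = ((dsp A B C D E)⁻¹).mulVec b)
    (L : Matrix (Fin k) (Idx n m p) ℝ)
    (Φ₁ : Matrix (Fin n × Fin n) (Fin s₁) ℝ)
    (Φ₂ : Matrix (Fin m × Fin m) (Fin r) ℝ)
    (Φ₃ : Matrix (Fin p × Fin p) (Fin q) ℝ)
    (hΦ₁01 : ∀ i j, Φ₁ i j = 0 ∨ Φ₁ i j = 1) (hΦ₁row : ∀ i, ∃! j, Φ₁ i j ≠ 0)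
    (hΦ₁col : ∀ j, ∃ i, Φ₁ i j ≠ 0)
    (hΦ₂01 : ∀ i j, Φ₂ i j = 0 ∨ Φ₂ i j = 1) (hΦ₂row : ∀ i, ∃! j, Φ₂ i j ≠ 0)
    (hΦ₂col : ∀ j, ∃ i, Φ₂ i j ≠ 0)
    (hΦ₃01 : ∀ i j, Φ₃ i j = 0 ∨ Φ₃ i j = 1) (hΦ₃row : ∀ i, ∃! j, Φ₃ i j ≠ 0)
    (hΦ₃col : ∀ j, ∃ i, Φ₃ i j ≠ 0)
    (ξ : Fin k → ℝ) (hξ : ∀ i, ξ i ≠ 0) (χ : Idx n m p → ℝ) (hχ : ∀ i, χ i ≠ 0)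
    (ψA : Fin s₁ → ℝ) (hψA : ∀ j, ψA j ≠ 0)
    (ψD : Fin r → ℝ) (hψD : ∀ j, ψD j ≠ 0)
    (ψE : Fin q → ℝ) (hψE : ∀ j, ψE j ≠ 0)
    (ΨA : Matrix (Fin n) (Fin n) ℝ) (hΨAdef : vecC ΨA = Φ₁.mulVec ψA)
    (ΨD : Matrix (Fin m) (Fin m) ℝ) (hΨDdef : vecC ΨD = Φ₂.mulVec ψD)
    (ΨE : Matrix (Fin p) (Fin p) ℝ) (hΨEdef : vecC ΨE = Φ₃.mulVec ψE)
    (ΨB : Matrix (Fin m) (Fin n) ℝ) (hΨB : ∀ i j, ΨB i j ≠ 0)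
    (ΨC : Matrix (Fin p) (Fin m) ℝ) (hΨC : ∀ i j, ΨC i j ≠ 0) :
    Tendsto (fun ε : ℝ => sSup {t : ℝ |
        ∃ (Δa : Fin s₁ → ℝ) (ΔB : Matrix (Fin m) (Fin n) ℝ) (ΔC : Matrix (Fin p) (Fin m) ℝ)
          (Δd : Fin r → ℝ) (Δe : Fin q → ℝ) (Δb : Idx n m p → ℝ)
          (ΔA : Matrix (Fin n) (Fin n) ℝ) (ΔD : Matrix (Fin m) (Fin m) ℝ)
          (ΔE : Matrix (Fin p) (Fin p) ℝ),
          vecC ΔA = Φ₁.mulVec Δa ∧ vecC ΔD = Φ₂.mulVec Δd ∧ vecC ΔE = Φ₃.mulVec Δe ∧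
          IsUnit (dsp A B C D E + dsp ΔA ΔB ΔC ΔD ΔE).det ∧
          0 < infNormV (structPert ψA ΨB ΨC ψD ψE χ Δa ΔB ΔC Δd Δe Δb) ∧
          infNormV (structPert ψA ΨB ΨC ψD ψE χ Δa ΔB ΔC Δd Δe Δb) ≤ ε ∧
          t = infNormV (fun i => (ξ i)⁻¹ *
                (L.mulVec (((dsp A B C D E + dsp ΔA ΔB ΔC ΔD ΔE)⁻¹).mulVec (b + Δb)) i
                  - L.mulVec (((dsp A B C D E)⁻¹).mulVec b) i)) /
              infNormV (structPert ψA ΨB ΨC ψD ψE χ Δa ΔB ΔC Δd Δe Δb)})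
      (𝓝[>] 0)
      (𝓝 (infNormV ((absM (Matrix.diagonal (fun i => (ξ i)⁻¹))).mulVec
          ((absM (L * (dsp A B C D E)⁻¹ *
              hcat (calG x y z) (-1 : Matrix (Idx n m p) (Idx n m p) ℝ) *
              Matrix.fromBlocks (PhiS Φ₁ Φ₂ Φ₃) 0 0
                (1 : Matrix (Idx n m p) (Idx n m p) ℝ))).mulVec
            (Sum.elim
              (Sum.elim (absV ψA)
                (Sum.elim (Sum.elim (vecC (absM ΨB)) (vecC (absM ΨC)))
                  (Sum.elim (absV ψD) (absV ψE))))
              (absV χ)))))) := by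
  have hσ : ∀ j, structVec ψA ΨB ΨC ψD ψE χ j ≠ 0 := by
    rintro ((j | (j | j) | j | j) | j)
    exacts [hψA j, hΨB _ _, hΨC _ _, hψD j, hψE j, hχ j]
  simp only [infNormV_eq_norm]
  convert tendsto_sSup_structured hB hw L (PhiS Φ₁ Φ₂ Φ₃) ξ hσ using 2
  · congr 1
    ext t
    constructor
    · rintro ⟨Δa, ΔB, ΔC, Δd, Δe, Δb, ΔA, ΔD, ΔE, hA, hD, hE, hdet, h0, hε, rfl⟩
      rw [dsp_eq_dspOfVec_PhiS ΔB ΔC Δb hA hD hE] at hdet ⊢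
      rw [structPert_eq] at h0 hε ⊢
      exact ⟨_, hdet, h0, hε, rfl⟩
    · rintro ⟨δ, hdet, h0, hε, rfl⟩
      obtain ⟨Δa, ΔB, ΔC, Δd, Δe, Δb, rfl⟩ := exists_structVec_eq δ
      refine ⟨Δa, ΔB, ΔC, Δd, Δe, Δb, Matrix.of fun i j => (Φ₁ *ᵥ Δa) (j, i),
        Matrix.of fun i j => (Φ₂ *ᵥ Δd) (j, i), Matrix.of fun i j => (Φ₃ *ᵥ Δe) (j, i),
        rfl, rfl, rfl, ?_⟩
      rw [dsp_eq_dspOfVec_PhiS (Φ₁ := Φ₁) (Φ₂ := Φ₂) (Φ₃ := Φ₃) ΔB ΔC Δb rfl rfl rfl,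
        structPert_eq]
      exact ⟨hdet, h0, hε, rfl⟩
  · congr 3
    ext ((j | (j | j) | j | j) | j) <;> rfl

end
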